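/- Under the general-N dressing, the functions u, v, q_1,…,q_N, r_1,…,r_N satisfy equation (E0) of the mixed-type KP system with N self-consistent sources (this is the zero-curvature component of the dressing theorem for the flows n=2, k=3). -/

import Mathlib

/-- Functions of the three variables (x, y, t). -/
abbrev F3 := ℝ → ℝ → ℝ → ℝ

/-- Smoothness (C^∞) of a function of (x,y,t). -/
def Smooth3 (f : F3) : Prop :=
  ContDiff ℝ (⊤ : ℕ∞) (fun p : ℝ × ℝ × ℝ => f p.1 p.2.1 p.2.2)

/-- Partial derivative in x. -/
noncomputable def px (f : F3) : F3 := fun x y t => deriv (fun x' => f x' y t) x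

/-- Partial derivative in y. -/
noncomputable def py (f : F3) : F3 := fun x y t => deriv (fun y' => f x y' t) y

/-- Partial derivative in t. -/
noncomputable def pt (f : F3) : F3 := fun x y t => deriv (fun t' => f x y t') t

/-- The linear flows: w_y = w_xx and w_t = w_xxx. -/
def LinFlow (w : F3) : Prop :=
  (∀ x y t, py w x y t = px (px w) x y t) ∧
  (∀ x y t, pt w x y t = px (px (px w)) x y t)

/-- Equation (E0) of the mixed-type KP system with N self-consistent sources. -/
def E0N (α β : ℝ) {N : ℕ} (u v : F3) (q r : Fin N → F3) : Prop :=
  ∀ x y t : ℝ,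
    4 * pt u x y t - 3 * py (py v) x y t - 12 * u x y t * px u x y t
      - px (px (px u)) x y t
      - 3 * α * py (fun x y t => ∑ i, q i x y t * r i x y t) x y t
      + 4 * β * px (fun x y t => ∑ i, q i x y t * r i x y t) x y t
      + 3 * α * ∑ i, (q i x y t * px (px (r i)) x y t - px (px (q i)) x y t * r i x y t)
      = 0

/-- Equation (Eq_i) of the mixed-type KP system with N self-consistent sources. -/
def EqN (α β : ℝ) {N : ℕ} (u v : F3) (q r : Fin N → F3) (i : Fin N) : Prop :=
  ∀ x y t : ℝ,
    α * (pt (q i) x y t - px (px (px (q i))) x y t - 3 * u x y t * px (q i) x y t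
        - (3/2) * q i x y t * py v x y t - (3/2) * q i x y t * px u x y t
        - (3/2) * q i x y t * ∑ j, q j x y t * r j x y t)
    - β * (py (q i) x y t - px (px (q i)) x y t - 2 * u x y t * q i x y t) = 0

/-- Equation (Er_i) of the mixed-type KP system with N self-consistent sources. -/
def ErN (α β : ℝ) {N : ℕ} (u v : F3) (q r : Fin N → F3) (i : Fin N) : Prop :=
  ∀ x y t : ℝ,
    α * (pt (r i) x y t - px (px (px (r i))) x y t - 3 * u x y t * px (r i) x y t
        + (3/2) * r i x y t * py v x y t - (3/2) * r i x y t * px u x y t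
        + (3/2) * r i x y t * ∑ j, q j x y t * r j x y t)
    - β * (py (r i) x y t + px (px (r i)) x y t + 2 * u x y t * r i x y t) = 0

/-- The m×m Wronskian (in x) of a family of functions of (x,y,t):
`Wr(p₁,…,p_m) = det(∂ₓ^{a−1} p_b)`. -/
noncomputable def WrN {m : ℕ} (h : Fin m → F3) : F3 :=
  fun x y t =>
    Matrix.det (Matrix.of fun a b : Fin m => iteratedDeriv a.1 (fun x' => h b x' y t) x)

section DifferentialAlgebra

open Matrix

variable {R A ι : Type*} [CommRing R] [CommRing A] [Algebra R A] [Fintype ι]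

theorem Derivation.map_ofNat_eq_zero (D : Derivation R A A) (k : ℕ) [k.AtLeastTwo] :
    D (ofNat(k) : A) = 0 :=
  D.map_natCast k

theorem Derivation.map_dotProduct (D : Derivation R A A) (x s : ι → A) :
    D (x ⬝ᵥ s) = (D ∘ x) ⬝ᵥ s + x ⬝ᵥ (D ∘ s) := by
  simp only [dotProduct, map_sum, Derivation.leibniz, smul_eq_mul, Function.comp_apply,
    ← Finset.sum_add_distrib]
  exact Finset.sum_congr rfl fun i _ => by ring

/-- Equation (E0) from the moment relations of the last column `r` of the inverse of the
Wronskian matrix: `H k` and `G k` are the `k`-th `x`-derivatives of the dressing functions and of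
the source directions, and `c` expresses `H (n + 1)` through the lower rows. -/
theorem sourceKP_of_moments (dx dy dt : Derivation R A A)
    (hxy : ∀ f, dy (dx f) = dx (dy f)) (hxt : ∀ f, dt (dx f) = dx (dt f))
    (a b : A) (hax : dx a = 0) (hay : dy a = 0) (hbx : dx b = 0)
    (H G : ℕ → ι → A) (hHx : ∀ k, dx ∘ H k = H (k + 1)) (hGx : ∀ k, dx ∘ G k = G (k + 1))
    (hHy : ∀ k, dy ∘ H k = H (k + 2) + a • G k)
    (hHt : ∀ k, dt ∘ H k = H (k + 3) + b • G k)
    (n : ℕ) (r ρ q : ι → A) (c : ℕ → A)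
    (hinj : ∀ s, (∀ k ≤ n, H k ⬝ᵥ s = 0) → s = 0)
    (hr : ∀ k < n, H k ⬝ᵥ r = 0) (hrn : H n ⬝ᵥ r = 1)
    (hρ : ∀ k ≤ n, H k ⬝ᵥ ρ = G k ⬝ᵥ r)
    (hc : H (n + 1) = ∑ k ∈ Finset.range (n + 1), c k • H k)
    (hq : q = ∑ k ∈ Finset.range (n + 1), c k • G k - G (n + 1)) :
    4 * dt (dx (c n)) - 3 * dy (dy (c n)) - 12 * dx (c n) * dx (dx (c n))
      - dx (dx (dx (dx (c n)))) - 3 * a * dy (q ⬝ᵥ r) + 4 * b * dx (q ⬝ᵥ r)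
      + 3 * a * (q ⬝ᵥ (dx ∘ dx ∘ r) - (dx ∘ dx ∘ q) ⬝ᵥ r) = 0 := by
  have hcn : H (n + 1) ⬝ᵥ r = c n := by
    rw [hc, sum_dotProduct, Finset.sum_range_succ, Finset.sum_eq_zero]
    · simp [hrn]
    · intro k hk
      simp [hr k (Finset.mem_range.1 hk)]
  -- moments of the derivatives of `r`
  have h1 : ∀ (s : ι → A) k, H k ⬝ᵥ (dx ∘ s) = dx (H k ⬝ᵥ s) - H (k + 1) ⬝ᵥ s := fun s k => by
    rw [dx.map_dotProduct, hHx]; ring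
  have hconst : ∀ (D : Derivation R A A), ∀ k ≤ n, D (H k ⬝ᵥ r) = 0 := fun D k hk => by
    rcases hk.lt_or_eq with hk | rfl
    · rw [hr k hk, map_zero]
    · rw [hrn, Derivation.map_one_eq_zero]
  have hyk : ∀ k, H k ⬝ᵥ (dy ∘ r) = dy (H k ⬝ᵥ r) - H (k + 2) ⬝ᵥ r - a * G k ⬝ᵥ r := fun k => by
    rw [dy.map_dotProduct, hHy, add_dotProduct, smul_dotProduct, smul_eq_mul]; ring
  have htk : ∀ k, H k ⬝ᵥ (dt ∘ r) = dt (H k ⬝ᵥ r) - H (k + 3) ⬝ᵥ r - b * G k ⬝ᵥ r := fun k => by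
    rw [dt.map_dotProduct, hHt, add_dotProduct, smul_dotProduct, smul_eq_mul]; ring
  have hxxk : ∀ k, H k ⬝ᵥ (dx ∘ dx ∘ r) = dx (dx (H k ⬝ᵥ r)) - 2 * dx (H (k + 1) ⬝ᵥ r)
      + H (k + 2) ⬝ᵥ r := fun k => by
    rw [h1, h1, h1, map_sub]; ring
  have hxxxk : ∀ k, H k ⬝ᵥ (dx ∘ dx ∘ dx ∘ r) = dx (dx (dx (H k ⬝ᵥ r)))
      - 3 * dx (dx (H (k + 1) ⬝ᵥ r)) + 3 * dx (H (k + 2) ⬝ᵥ r) - H (k + 3) ⬝ᵥ r := fun k => by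
    rw [h1, hxxk, hxxk]
    simp only [map_sub, map_add, Derivation.leibniz, Derivation.map_ofNat_eq_zero, smul_eq_mul]
    ring
  -- evolution of `r`
  have hry : dy ∘ r + dx ∘ dx ∘ r + (2 * dx (c n)) • r + a • ρ = 0 := hinj _ fun k hk => by
    simp only [dotProduct_add, dotProduct_smul, hyk, hxxk, smul_eq_mul, hρ k hk, hconst _ k hk,
      map_zero]
    rcases hk.lt_or_eq with hk | rfl
    · rw [hconst dx (k + 1) hk, hr k hk]; ring
    · rw [hcn, hrn]; ring
  set m₂ := H (n + 2) ⬝ᵥ r with hm₂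
  have hrt : dt ∘ r - dx ∘ dx ∘ dx ∘ r + b • ρ - (3 * dx (c n)) • (dx ∘ r)
      - (3 * dx (dx (c n)) - 3 * dx m₂ + 3 * dx (c n) * c n) • r = 0 := hinj _ fun k hk => by
    simp only [dotProduct_add, dotProduct_sub, dotProduct_smul, htk, hxxxk, h1 r, smul_eq_mul,
      hρ k hk, hconst _ k hk, map_zero]
    rcases hk.lt_or_eq with hk | rfl
    · rw [hconst dx (k + 1) hk, hr k hk]
      rcases (Nat.succ_le_of_lt hk).lt_or_eq with hk' | hk'
      · rw [hconst dx (k + 2) hk', hr (k + 1) hk', map_zero]; ring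
      · subst hk'
        rw [hcn, hrn, map_zero]; ring
    · rw [hcn, hrn]; ring
  -- evolution of the moments
  set Q := q ⬝ᵥ r with hQ
  have hqs : ∀ s, q ⬝ᵥ s = (∑ k ∈ Finset.range (n + 1), c k * G k ⬝ᵥ s) - G (n + 1) ⬝ᵥ s :=
    fun s => by simp [hq, sub_dotProduct, sum_dotProduct]
  have hHs : ∀ s, H (n + 1) ⬝ᵥ s = ∑ k ∈ Finset.range (n + 1), c k * H k ⬝ᵥ s :=
    fun s => by simp [hc, sum_dotProduct]
  have hQρ : H (n + 1) ⬝ᵥ ρ - G (n + 1) ⬝ᵥ r = Q := by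
    rw [hQ, hqs, hHs, Finset.sum_congr rfl fun k hk => ?_]
    rw [hρ k (Nat.lt_succ_iff.1 (Finset.mem_range.1 hk))]
  set Q₁ := H (n + 2) ⬝ᵥ ρ - G (n + 2) ⬝ᵥ r with hQ₁
  have hvy : dy (c n) = -dx (dx (c n)) + 2 * dx m₂ - 2 * dx (c n) * c n - a * Q := by
    have := congrArg (H (n + 1) ⬝ᵥ ·) hry
    simp only [dotProduct_add, dotProduct_smul, hyk, hxxk, smul_eq_mul, dotProduct_zero, hcn,
      ← hm₂, show n + 1 + 1 = n + 2 from rfl] at this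
    linear_combination this - a * hQρ
  have hvt : dt (c n) = dx (dx (dx (c n))) - 3 * dx (dx m₂) + 3 * dx (H (n + 3) ⬝ᵥ r) - b * Q
      + 3 * dx (c n) * (dx (c n) - m₂)
      + (3 * dx (dx (c n)) - 3 * dx m₂ + 3 * dx (c n) * c n) * c n := by
    have := congrArg (H (n + 1) ⬝ᵥ ·) hrt
    simp only [dotProduct_add, dotProduct_sub, dotProduct_smul, htk, hxxxk, h1 r, smul_eq_mul,
      dotProduct_zero, hcn, ← hm₂, show n + 1 + 1 = n + 2 from rfl,
      show n + 1 + 2 = n + 3 from rfl] at this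
    linear_combination this - b * hQρ
  have hmy : dy m₂ = -dx (dx m₂) + 2 * dx (H (n + 3) ⬝ᵥ r) - 2 * dx (c n) * m₂ - a * Q₁ := by
    have := congrArg (H (n + 2) ⬝ᵥ ·) hry
    simp only [dotProduct_add, dotProduct_smul, hyk, hxxk, smul_eq_mul, dotProduct_zero,
      ← hm₂, show n + 2 + 1 = n + 3 from rfl] at this
    linear_combination this - a * hQ₁
  -- the flux of the sources
  have hρx : ∀ k, k ≤ n → H k ⬝ᵥ (dx ∘ ρ) = G k ⬝ᵥ (dx ∘ r) - if k = n then Q else 0 := by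
    intro k hk
    rw [h1, hρ k hk, dx.map_dotProduct, hGx]
    split_ifs with h
    · subst h
      linear_combination -hQρ
    · rw [hρ (k + 1) (lt_of_le_of_ne hk h)]; ring
  have hflux : dx Q = Q₁ + q ⬝ᵥ (dx ∘ r) - c n * Q := by
    have h2 : H (n + 1) ⬝ᵥ (dx ∘ ρ) - G (n + 1) ⬝ᵥ (dx ∘ r) = q ⬝ᵥ (dx ∘ r) - c n * Q := by
      rw [hqs, hHs, Finset.sum_congr rfl fun k hk => by
        rw [hρx k (Nat.lt_succ_iff.1 (Finset.mem_range.1 hk))]]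
      simp [mul_sub]
      ring
    have h3 := congrArg dx hQρ
    rw [map_sub, dx.map_dotProduct, dx.map_dotProduct, hHx, hGx] at h3
    linear_combination h2 - h3 - hQ₁
  have hskew : q ⬝ᵥ (dx ∘ dx ∘ r) - (dx ∘ dx ∘ q) ⬝ᵥ r
      = dx (2 * (q ⬝ᵥ (dx ∘ r)) - dx Q) := by
    rw [hQ, map_sub, dx.map_dotProduct q r, map_add, dx.map_dotProduct (dx ∘ q) r,
      Derivation.leibniz, Derivation.map_ofNat_eq_zero, dx.map_dotProduct q (dx ∘ r)]
    simp only [smul_eq_mul]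
    ring
  have hpot : 4 * dt (c n) - 3 * (-dx (dy (c n)) + 2 * dy m₂ - 2 * c n * dy (c n))
      - 6 * dx (c n) * dx (c n) - dx (dx (dx (c n))) + 4 * b * Q
      + 3 * a * (2 * (q ⬝ᵥ (dx ∘ r)) - dx Q) = 0 := by
    have h4 := congrArg dx hvy
    simp only [map_sub, map_add, map_neg, Derivation.leibniz, Derivation.map_ofNat_eq_zero,
      smul_eq_mul, hax] at h4
    linear_combination 4 * hvt + 3 * h4 - 6 * hmy + 6 * c n * hvy - 6 * a * hflux
  have h5 := congrArg dx hpot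
  have h6 := congrArg dy hvy
  rw [hskew]
  simp only [map_sub, map_add, map_neg, map_zero, Derivation.leibniz, Derivation.map_ofNat_eq_zero,
    smul_eq_mul, hax, hay, hbx, hxy, hxt] at h5 h6 ⊢
  linear_combination h5 - 3 * h6

theorem Derivation.map_prod_eq_sum_update [DecidableEq ι] (D : Derivation R A A) (f : ι → A) :
    D (∏ i, f i) = ∑ i, ∏ j, Function.update f i (D (f i)) j := by
  have key : ∀ s : Finset ι, D (∏ i ∈ s, f i)
      = ∑ i ∈ s, ∏ j ∈ s, Function.update f i (D (f i)) j := by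
    intro s
    induction s using Finset.induction_on with
    | empty => simp
    | insert a s ha ih =>
      have hs : ∀ i ∈ s, ∏ j ∈ insert a s, Function.update f i (D (f i)) j
          = f a * ∏ j ∈ s, Function.update f i (D (f i)) j := fun i hi => by
        rw [Finset.prod_insert ha, Function.update_of_ne (ne_of_mem_of_not_mem hi ha).symm]
      have ha' : ∏ j ∈ insert a s, Function.update f a (D (f a)) j = D (f a) * ∏ j ∈ s, f j := by
        rw [Finset.prod_insert ha, Function.update_self, Finset.prod_congr rfl fun j hj =>
          Function.update_of_ne (ne_of_mem_of_not_mem hj ha) _ f]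
      rw [Finset.prod_insert ha, D.leibniz, ih, Finset.sum_insert ha, Finset.sum_congr rfl hs, ha',
        ← Finset.mul_sum, smul_eq_mul, smul_eq_mul]
      ring
  exact key Finset.univ

theorem Derivation.map_det_eq_sum_updateRow [DecidableEq ι] (D : Derivation R A A)
    (M : Matrix ι ι A) : D M.det = ∑ k, (M.updateRow k (D ∘ M k)).det := by
  simp only [← det_transpose M, ← det_transpose (M.updateRow _ _), det_apply, map_sum,
    transpose_apply]
  rw [Finset.sum_comm]
  refine Finset.sum_congr rfl fun σ _ => ?_
  rw [← Finset.smul_sum, Units.smul_def, Units.smul_def, map_zsmul, D.map_prod_eq_sum_update]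
  congr 1
  refine Finset.sum_congr rfl fun k _ => Finset.prod_congr rfl fun j _ => ?_
  rcases eq_or_ne j k with rfl | h
  · simp
  · simp [h]

/-- The Wronskian matrix of a finite family with respect to a derivation. -/
def wronskianMatrix (D : Derivation R A A) {m : ℕ} (h : Fin m → A) : Matrix (Fin m) (Fin m) A :=
  Matrix.of fun k i => D^[k] (h i)

/-- If `c` expresses the `(n + 1)`-st derivatives of `h` through the lower ones, the Wronskian
of `h` has logarithmic derivative `c n`. -/
theorem derivation_wronskian (D : Derivation R A A) {n : ℕ} (h : Fin (n + 1) → A)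
    (c : ℕ → A) (hc : ∀ i, D^[n + 1] (h i) = ∑ k ∈ Finset.range (n + 1), c k * D^[k] (h i)) :
    D (wronskianMatrix D h).det = c n * (wronskianMatrix D h).det := by
  rw [D.map_det_eq_sum_updateRow, Fin.sum_univ_castSucc, Finset.sum_eq_zero, zero_add]
  · have hrow : D ∘ wronskianMatrix D h (Fin.last n)
        = ∑ k : Fin (n + 1), c k • wronskianMatrix D h k := by
      ext i
      simp only [wronskianMatrix, Function.comp_apply, of_apply, Fin.val_last, Finset.sum_apply,
        Pi.smul_apply, smul_eq_mul]
      rw [← Function.iterate_succ_apply' (⇑D), hc, Finset.sum_range]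
    rw [hrow, det_updateRow_sum, Fin.val_last, smul_eq_mul]
  · intro k _
    have hrow : D ∘ wronskianMatrix D h k.castSucc = wronskianMatrix D h k.succ := by
      ext i
      simp [wronskianMatrix, -Function.iterate_succ, Function.iterate_succ_apply']
    rw [hrow, det_updateRow_eq_zero (Fin.castSucc_lt_succ).ne']

/-- If `c` expresses the `(n + 1)`-st derivatives of `h` through the lower ones, appending a
function multiplies the Wronskian by the value of the associated monic operator. -/
theorem wronskian_snoc (D : Derivation R A A) {n : ℕ} (h : Fin (n + 1) → A) (g : A)
    (c : ℕ → A) (hc : ∀ i, D^[n + 1] (h i) = ∑ k ∈ Finset.range (n + 1), c k * D^[k] (h i)) :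
    (wronskianMatrix D (Fin.snoc h g : Fin (n + 2) → A)).det
      = (D^[n + 1] g - ∑ k ∈ Finset.range (n + 1), c k * D^[k] g)
        * (wronskianMatrix D h).det := by
  set M := wronskianMatrix D (Fin.snoc h g : Fin (n + 2) → A) with hM
  have hsum := det_updateRow_sum M (Fin.last (n + 1))
    (Fin.snoc (fun k : Fin (n + 1) => -c k) 1 : Fin (n + 2) → A)
  rw [Fin.snoc_last, one_smul] at hsum
  have hrow : (∑ k, (Fin.snoc (fun k : Fin (n + 1) => -c k) 1 : Fin (n + 2) → A) k • M k)
      = Pi.single (Fin.last (n + 1))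
          (D^[n + 1] g - ∑ k ∈ Finset.range (n + 1), c k * D^[k] g) := by
    ext i
    simp only [Fin.sum_univ_castSucc (n := n + 1), Fin.snoc_castSucc, Fin.snoc_last, hM,
      wronskianMatrix, Finset.sum_apply, Pi.smul_apply, of_apply, smul_eq_mul,
      Fin.val_castSucc, Fin.val_last, one_mul, neg_mul, Finset.sum_neg_distrib]
    induction i using Fin.lastCases with
    | last => rw [Pi.single_eq_same, Finset.sum_range, Fin.snoc_last]; ring
    | cast i =>
      rw [Pi.single_eq_of_ne (Fin.castSucc_lt_last i).ne, Fin.snoc_castSucc, hc, Finset.sum_range]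
      ring
  rw [← hsum, hrow, det_succ_row _ (Fin.last (n + 1)), Finset.sum_eq_single (Fin.last (n + 1))]
  · rw [updateRow_self, Pi.single_eq_same, submatrix_updateRow_succAbove, Even.neg_one_pow ⟨_, rfl⟩,
      one_mul]
    congr 2
    ext k i
    simp [hM, wronskianMatrix]
  · intro i _ hi
    simp [hi]
  · simp

/-- Equation (E0) for the Wronskian dressing in a differential ring; `τi` is the inverse of the
Wronskian of `h`. -/
theorem sourceKP_of_wronskian (dx dy dt : Derivation R A A)
    (hxy : ∀ f, dy (dx f) = dx (dy f)) (hxt : ∀ f, dt (dx f) = dx (dt f))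
    (a b : A) (hax : dx a = 0) (hay : dy a = 0) (hbx : dx b = 0)
    {n : ℕ} (h g φ : Fin (n + 1) → A) (hφ : ∀ i, dx (φ i) = 0)
    (hhy : ∀ i, dy (h i) = dx (dx (h i)) + a * (φ i * g i))
    (hht : ∀ i, dt (h i) = dx (dx (dx (h i))) + b * (φ i * g i))
    (τi : A) (hτ : (wronskianMatrix dx h).det * τi = 1)
    (v : A) (hv : v = dx (wronskianMatrix dx h).det * τi)
    (q r : Fin (n + 1) → A)
    (hq : ∀ i, q i = -φ i * ((wronskianMatrix dx (Fin.snoc h (g i) : Fin (n + 2) → A)).det * τi))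
    (hr : ∀ i, r i = (-1) ^ (n - i.1) *
      ((wronskianMatrix dx (fun j => h (i.succAbove j))).det * τi)) :
    4 * dt (dx v) - 3 * dy (dy v) - 12 * dx v * dx (dx v)
      - dx (dx (dx (dx v))) - 3 * a * dy (∑ i, q i * r i) + 4 * b * dx (∑ i, q i * r i)
      + 3 * a * ∑ i, (q i * dx (dx (r i)) - dx (dx (q i)) * r i) = 0 := by
  set M := wronskianMatrix dx h with hM
  set P : Matrix (Fin (n + 1)) (Fin (n + 1)) A := τi • M.adjugate with hP
  have hMP : M * P = 1 := by
    rw [hP, Matrix.mul_smul, mul_adjugate, smul_smul, mul_comm, hτ, one_smul]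
  have hPM : P * M = 1 := mul_eq_one_comm.1 hMP
  let H : ℕ → Fin (n + 1) → A := fun k i => dx^[k] (h i)
  let G : ℕ → Fin (n + 1) → A := fun k i => φ i * dx^[k] (g i)
  have hMH : ∀ k : Fin (n + 1), M k = H k := fun k => rfl
  let c : ℕ → A := fun k => if hk : k < n + 1 then (H (n + 1) ᵥ* P) ⟨k, hk⟩ else 0
  have hcH : H (n + 1) = ∑ k ∈ Finset.range (n + 1), c k • H k := by
    have h1 : H (n + 1) = (H (n + 1) ᵥ* P) ᵥ* M := by rw [vecMul_vecMul, hPM, vecMul_one]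
    conv_lhs => rw [h1]
    ext i
    rw [Finset.sum_range, vecMul_eq_sum, Finset.sum_apply, Finset.sum_apply]
    refine Finset.sum_congr rfl fun k _ => ?_
    simp only [c, dif_pos k.2, hMH]
  have hc : ∀ i, dx^[n + 1] (h i) = ∑ k ∈ Finset.range (n + 1), c k * dx^[k] (h i) := fun i => by
    simpa [H] using congrFun hcH i
  have hvc : v = c n := by
    rw [hv, hM, derivation_wronskian dx h c hc, mul_assoc, ← hM, hτ, mul_one]
  have hxk : ∀ k f, dx (dx^[k] f) = dx^[k + 1] f := fun k f =>
    (Function.iterate_succ_apply' _ _ _).symm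
  have hφk : ∀ i k f, dx^[k] (φ i * f) = φ i * dx^[k] f := fun i k f => by
    induction k with
    | zero => rfl
    | succ k ih =>
      rw [← hxk, ih, Derivation.leibniz, hφ, smul_zero, add_zero, smul_eq_mul, hxk]
  have hflow : ∀ (D : Derivation R A A) (e : A), dx e = 0 → (∀ f, D (dx f) = dx (D f)) →
      ∀ m i, D (h i) = dx^[m] (h i) + e * (φ i * g i) →
      ∀ k, D (dx^[k] (h i)) = dx^[k + m] (h i) + e * (φ i * dx^[k] (g i)) := by
    intro D e he hD m i hi k
    induction k with
    | zero => simpa using hi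
    | succ k ih =>
      rw [← hxk, hD, ih, map_add, hxk, Derivation.leibniz, he, Derivation.leibniz, hφ, hxk,
        show k + m + 1 = k + 1 + m by ring]
      simp
  have hrP : ∀ i, r i = P i (Fin.last n) := fun i => by
    rw [hr, hP, Matrix.smul_apply, adjugate_fin_succ_eq_det_submatrix, smul_eq_mul]
    have hs : (-1 : A) ^ (n - i.1) = (-1) ^ ((Fin.last n : ℕ) + i.1) := by
      rw [Fin.val_last, show n + i.1 = n - i.1 + (i.1 + i.1) by omega, pow_add _ (n - i.1),
        Even.neg_one_pow (Even.add_self _), mul_one]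
    rw [hs]
    have hdet : (wronskianMatrix dx fun j => h (i.succAbove j))
        = M.submatrix (Fin.last n).succAbove i.succAbove := by
      ext k j
      simp [hM, wronskianMatrix]
    rw [hdet]
    ring
  have hHr : ∀ k : Fin (n + 1), H k ⬝ᵥ r = if k = Fin.last n then 1 else 0 := fun k => by
    rw [← hMH, ← one_apply, ← hMP, mul_apply]
    exact Finset.sum_congr rfl fun i _ => by rw [hrP]
  have main := sourceKP_of_moments dx dy dt hxy hxt a b hax hay hbx H G
    (fun k => funext fun i => hxk k _)
    (fun k => funext fun i => by simp only [G, Function.comp_apply, ← hφk, hxk])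
    (fun k => funext fun i => hflow dy a hax hxy 2 i (hhy i) k)
    (fun k => funext fun i => hflow dt b hbx hxt 3 i (hht i) k)
    n r (P *ᵥ fun k => G k ⬝ᵥ r) q c
    (fun s hs => by
      rw [← one_mulVec s, ← hPM, ← mulVec_mulVec, show M *ᵥ s = 0 from
        funext fun k => hs k (Nat.lt_succ_iff.1 k.2), mulVec_zero])
    (fun k hk => by
      rw [hHr ⟨k, hk.trans n.lt_succ_self⟩, if_neg]
      exact fun h => hk.ne (congrArg Fin.val h))
    ((hHr (Fin.last n)).trans (if_pos rfl))
    (fun k hk => by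
      have := congrFun (mulVec_mulVec (fun k : Fin (n + 1) => G k ⬝ᵥ r) M P)
        ⟨k, Nat.lt_succ_iff.2 hk⟩
      rw [hMP, one_mulVec] at this
      exact this)
    hcH
    (funext fun i => by
      rw [hq, wronskian_snoc dx h (g i) c hc, mul_assoc, ← hM, hτ]
      simp only [G, Pi.sub_apply, Finset.sum_apply, Pi.smul_apply, smul_eq_mul, mul_one,
        mul_left_comm _ (φ i), ← Finset.mul_sum]
      ring)
  rw [hvc]
  simpa only [dotProduct, Function.comp_apply, ← Finset.sum_sub_distrib] using main

end DifferentialAlgebra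
section SmoothFunctions

open scoped ContDiff

/-- The algebra of smooth functions of (x,y,t). -/
def smoothFunctions : Subalgebra ℝ (ℝ × ℝ × ℝ → ℝ) where
  carrier := {f | ContDiff ℝ ∞ f}
  mul_mem' hf hg := ContDiff.mul (𝕜 := ℝ) (n := ∞) hf hg
  add_mem' hf hg := ContDiff.add (𝕜 := ℝ) (n := ∞) hf hg
  algebraMap_mem' c := show ContDiff ℝ ∞ fun _ => c from contDiff_const

namespace smoothFunctions

/-- A smooth function in curried form. -/
def toF3 (f : smoothFunctions) : F3 := fun x y t => f.1 (x, y, t)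

/-- The smooth function given by a curried one. -/
def ofF3 (f : F3) (hf : Smooth3 f) : smoothFunctions := ⟨fun p => f p.1 p.2.1 p.2.2, hf⟩

/-- Evaluation at a point. -/
def eval (x y t : ℝ) : smoothFunctions →+* ℝ :=
  (Pi.evalRingHom (fun _ => ℝ) (x, y, t)).comp smoothFunctions.val.toRingHom

theorem eval_apply (x y t : ℝ) (f : smoothFunctions) : eval x y t f = toF3 f x y t := rfl

theorem contDiff (f : smoothFunctions) : ContDiff ℝ ∞ f.1 := f.2

theorem differentiable (f : smoothFunctions) : Differentiable ℝ f.1 :=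
  (contDiff f).differentiable (by simp)

/-- The directional derivative along a constant vector field. -/
noncomputable def dirDeriv (e : ℝ × ℝ × ℝ) : Derivation ℝ smoothFunctions smoothFunctions :=
  Derivation.mk'
    { toFun := fun f => ⟨fun p => fderiv ℝ f.1 p e,
        ((contDiff f).fderiv_right (m := ∞) (by simp)).clm_apply contDiff_const⟩
      map_add' := fun f g => Subtype.ext <| funext fun p => by
        have := congrArg (· e) (fderiv_add (differentiable f p) (differentiable g p))
        exact this
      map_smul' := fun c f => Subtype.ext <| funext fun p => by
        have := congrArg (· e) (fderiv_const_smul (differentiable f p) c)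
        exact this }
    fun f g => Subtype.ext <| funext fun p => by
      have := congrArg (· e) (fderiv_mul (differentiable f p) (differentiable g p))
      exact this

theorem dirDeriv_apply (e : ℝ × ℝ × ℝ) (f : smoothFunctions) (p : ℝ × ℝ × ℝ) :
    (dirDeriv e f).1 p = fderiv ℝ f.1 p e := rfl

theorem dirDeriv_comm (e e' : ℝ × ℝ × ℝ) (f : smoothFunctions) :
    dirDeriv e (dirDeriv e' f) = dirDeriv e' (dirDeriv e f) := by
  have key : ∀ (a b p : ℝ × ℝ × ℝ),
      (dirDeriv a (dirDeriv b f)).1 p = fderiv ℝ (fderiv ℝ f.1) p a b := fun a b p => by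
    rw [dirDeriv_apply, show (dirDeriv b f).1 = fun p => fderiv ℝ f.1 p b from rfl,
      fderiv_clm_apply]
    · simp
    · exact ((contDiff f).fderiv_right (m := ∞) (by simp)).differentiable (by simp) p
    · exact differentiableAt_const _
  refine Subtype.ext <| funext fun p => ?_
  rw [key, key]
  exact (contDiff f).contDiffAt.isSymmSndFDerivAt
    (by rw [minSmoothness_of_isRCLikeNormedField]; exact ENat.LEInfty.out) e e'

theorem px_toF3 (f : smoothFunctions) : px (toF3 f) = toF3 (dirDeriv (1, 0, 0) f) := by
  ext x y t
  exact ((differentiable f (x, y, t)).hasFDerivAt.comp_hasDerivAt x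
    ((hasDerivAt_id x).prodMk (hasDerivAt_const x (y, t)))).deriv

theorem py_toF3 (f : smoothFunctions) : py (toF3 f) = toF3 (dirDeriv (0, 1, 0) f) := by
  ext x y t
  exact ((differentiable f (x, y, t)).hasFDerivAt.comp_hasDerivAt y
    ((hasDerivAt_const y x).prodMk ((hasDerivAt_id y).prodMk (hasDerivAt_const y t)))).deriv

theorem pt_toF3 (f : smoothFunctions) : pt (toF3 f) = toF3 (dirDeriv (0, 0, 1) f) := by
  ext x y t
  exact ((differentiable f (x, y, t)).hasFDerivAt.comp_hasDerivAt t
    ((hasDerivAt_const t x).prodMk ((hasDerivAt_const t y).prodMk (hasDerivAt_id t)))).deriv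

theorem toF3_injective : Function.Injective toF3 := fun _ _ h =>
  Subtype.ext <| funext fun p => congrFun (congrFun (congrFun h p.1) p.2.1) p.2.2

theorem iteratedDeriv_toF3 (f : smoothFunctions) (k : ℕ) (x y t : ℝ) :
    iteratedDeriv k (fun x' => toF3 f x' y t) x = toF3 ((dirDeriv (1, 0, 0))^[k] f) x y t := by
  induction k generalizing x with
  | zero => simp
  | succ k ih =>
    rw [iteratedDeriv_succ, Function.iterate_succ_apply', ← px_toF3]
    exact congrArg (fun F => deriv F x) (funext ih)

theorem WrN_toF3 {m : ℕ} (h : Fin m → smoothFunctions) :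
    WrN (fun i => toF3 (h i)) = toF3 (wronskianMatrix (dirDeriv (1, 0, 0)) h).det := by
  ext x y t
  rw [← eval_apply, RingHom.map_det]
  unfold WrN
  congr 1
  ext k i
  exact iteratedDeriv_toF3 (h i) k x y t

/-- The reciprocal of a nowhere vanishing smooth function. -/
noncomputable def recip (f : smoothFunctions) (hf : ∀ x y t, toF3 f x y t ≠ 0) : smoothFunctions :=
  ⟨fun p => (f.1 p)⁻¹, (contDiff f).inv fun p => hf p.1 p.2.1 p.2.2⟩

theorem mul_recip (f : smoothFunctions) (hf : ∀ x y t, toF3 f x y t ≠ 0) : f * recip f hf = 1 :=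
  Subtype.ext <| funext fun p => mul_inv_cancel₀ (hf p.1 p.2.1 p.2.2)

/-- The smooth function `F (α y + β t)`. -/
def travelling (α β : ℝ) (F : ℝ → ℝ) (hF : ContDiff ℝ ∞ F) : smoothFunctions :=
  ⟨fun p => F (α * p.2.1 + β * p.2.2),
    hF.comp (f := fun p : ℝ × ℝ × ℝ => α * p.2.1 + β * p.2.2) (by fun_prop)⟩

theorem dirDeriv_travelling (α β : ℝ) (F : ℝ → ℝ) (hF : ContDiff ℝ ∞ F)
    (hF' : ContDiff ℝ ∞ (deriv F)) (e : ℝ × ℝ × ℝ) :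
    dirDeriv e (travelling α β F hF)
      = algebraMap ℝ smoothFunctions (α * e.2.1 + β * e.2.2) * travelling α β (deriv F) hF' := by
  refine Subtype.ext <| funext fun p => ?_
  have hL : HasFDerivAt (fun p : ℝ × ℝ × ℝ => α * p.2.1 + β * p.2.2)
      (α • (ContinuousLinearMap.fst ℝ ℝ ℝ).comp (ContinuousLinearMap.snd ℝ ℝ (ℝ × ℝ))
        + β • (ContinuousLinearMap.snd ℝ ℝ ℝ).comp (ContinuousLinearMap.snd ℝ ℝ (ℝ × ℝ))) p :=
    ((hasFDerivAt_snd.fst).const_mul α).add ((hasFDerivAt_snd.snd).const_mul β)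
  have hd := ((hF.differentiable (by simp) (α * p.2.1 + β * p.2.2)).hasDerivAt).comp_hasFDerivAt p hL
  have := congrArg (· e) hd.fderiv
  refine Eq.trans this ?_
  simp only [smul_apply, add_apply, smul_eq_mul]
  exact mul_comm _ _

/-- Equation (E0) read in the differential algebra of smooth functions. -/
theorem E0N_toF3 (α β : ℝ) {N : ℕ} (v : smoothFunctions) (q r : Fin N → smoothFunctions)
    (h : 4 * dirDeriv (0, 0, 1) (dirDeriv (1, 0, 0) v)
      - 3 * dirDeriv (0, 1, 0) (dirDeriv (0, 1, 0) v)
      - 12 * dirDeriv (1, 0, 0) v * dirDeriv (1, 0, 0) (dirDeriv (1, 0, 0) v)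
      - dirDeriv (1, 0, 0) (dirDeriv (1, 0, 0) (dirDeriv (1, 0, 0) (dirDeriv (1, 0, 0) v)))
      - 3 * algebraMap ℝ smoothFunctions α * dirDeriv (0, 1, 0) (∑ i, q i * r i)
      + 4 * algebraMap ℝ smoothFunctions β * dirDeriv (1, 0, 0) (∑ i, q i * r i)
      + 3 * algebraMap ℝ smoothFunctions α *
        ∑ i, (q i * dirDeriv (1, 0, 0) (dirDeriv (1, 0, 0) (r i))
          - dirDeriv (1, 0, 0) (dirDeriv (1, 0, 0) (q i)) * r i) = 0) :
    E0N α β (px (toF3 v)) (toF3 v) (fun i => toF3 (q i)) (fun i => toF3 (r i)) := by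
  intro x y t
  have hsum : (fun x y t => ∑ i, toF3 (q i) x y t * toF3 (r i) x y t)
      = toF3 (∑ i, q i * r i) := by
    ext x y t
    simp only [← eval_apply, map_sum, map_mul]
  have hconst : ∀ s, eval x y t (algebraMap ℝ smoothFunctions s) = s := fun _ => rfl
  have h' := congrArg (eval x y t) h
  rw [hsum]
  simp only [px_toF3, py_toF3, pt_toF3, ← eval_apply]
  simpa only [map_add (eval x y t), map_sub (eval x y t), map_mul (eval x y t),
    map_sum (eval x y t), map_ofNat (eval x y t), map_zero (eval x y t), hconst] using h'

end smoothFunctions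

end SmoothFunctions

open smoothFunctions in
/-- under the general-N dressing (here N = n+1 ≥ 1), equation (E0) of the mixed-type KP system with N self-consistent sources holds. -/
theorem dressing_E0 (α β : ℝ) (n : ℕ) (f g : Fin (n + 1) → F3) (F : Fin (n + 1) → ℝ → ℝ)
    (hf : ∀ i, Smooth3 (f i)) (hg : ∀ i, Smooth3 (g i))
    (hF : ∀ i, ContDiff ℝ (⊤ : ℕ∞) (F i))
    (hfl : ∀ i, LinFlow (f i)) (hgl : ∀ i, LinFlow (g i))
    (h : Fin (n + 1) → F3)
    (hh : ∀ i, h i = fun x y t => f i x y t + F i (α * y + β * t) * g i x y t)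
    (hne : ∀ x y t, WrN h x y t ≠ 0)
    (v u : F3) (q r : Fin (n + 1) → F3)
    (hv : v = fun x y t => px (WrN h) x y t / WrN h x y t)
    (hu : u = px v)
    (hq : ∀ i, q i = fun x y t => -(deriv (F i) (α * y + β * t)) *
      (WrN (Fin.snoc h (g i)) x y t / WrN h x y t))
    (hr : ∀ i, r i = fun x y t => (-1 : ℝ) ^ (n - i.1) *
      (WrN (fun j => h (i.succAbove j)) x y t / WrN h x y t))
    : E0N α β u v q r := by
  have hF' : ∀ i, ContDiff ℝ (⊤ : ℕ∞) (deriv (F i)) := fun i =>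
    ((contDiff_infty_iff_deriv (𝕜 := ℝ)).1 (hF i)).2
  let fS : Fin (n + 1) → smoothFunctions := fun i => ofF3 (f i) (hf i)
  let gS : Fin (n + 1) → smoothFunctions := fun i => ofF3 (g i) (hg i)
  let φS : Fin (n + 1) → smoothFunctions := fun i => travelling α β (deriv (F i)) (hF' i)
  let hS : Fin (n + 1) → smoothFunctions := fun i => fS i + travelling α β (F i) (hF i) * gS i
  have hhS : h = fun i => toF3 (hS i) := funext hh
  have hτ : WrN h = toF3 (wronskianMatrix (dirDeriv (1, 0, 0)) hS).det := by rw [hhS, WrN_toF3]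
  rw [hτ] at hne
  let τi := recip _ hne
  have hvS : v = toF3 (dirDeriv (1, 0, 0) (wronskianMatrix (dirDeriv (1, 0, 0)) hS).det * τi) := by
    rw [hv, hτ, px_toF3]; rfl
  have hqS : ∀ i, q i = toF3 (-φS i * ((wronskianMatrix (dirDeriv (1, 0, 0))
      (Fin.snoc hS (gS i) : Fin (n + 2) → smoothFunctions)).det * τi)) := fun i => by
    have hsnoc : (Fin.snoc h (g i) : Fin (n + 2) → F3)
        = fun j => toF3 ((Fin.snoc hS (gS i) : Fin (n + 2) → smoothFunctions) j) := by
      ext j : 1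
      induction j using Fin.lastCases with
      | last => rw [Fin.snoc_last, Fin.snoc_last]; rfl
      | cast j => rw [Fin.snoc_castSucc, Fin.snoc_castSucc, hhS]
    rw [hq, hτ, hsnoc, WrN_toF3]; rfl
  have hrS : ∀ i, r i = toF3 ((-1) ^ (n - i.1) * ((wronskianMatrix (dirDeriv (1, 0, 0))
      (fun j => hS (i.succAbove j))).det * τi)) := fun i => by
    rw [hr, hτ, hhS, WrN_toF3]
    ext x y t
    simp only [← eval_apply, map_mul, map_pow, map_neg, map_one]
    rfl
  have hflow : ∀ (e : ℝ × ℝ × ℝ) (i : Fin (n + 1)) (d : smoothFunctions → smoothFunctions),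
      (∀ w₁ w₂, d (w₁ + travelling α β (F i) (hF i) * w₂)
        = d w₁ + travelling α β (F i) (hF i) * d w₂) →
      dirDeriv e (fS i) = d (fS i) → dirDeriv e (gS i) = d (gS i) →
      dirDeriv e (hS i) = d (hS i)
        + algebraMap ℝ smoothFunctions (α * e.2.1 + β * e.2.2) * (φS i * gS i) := by
    intro e i d hd h₁ h₂
    simp only [hS, hd, map_add, Derivation.leibniz, h₁, h₂, smul_eq_mul,
      dirDeriv_travelling α β (F i) (hF i) (hF' i)]
    ring
  have hFx : ∀ i, dirDeriv (1, 0, 0) (travelling α β (F i) (hF i)) = 0 := fun i => by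
    simp [dirDeriv_travelling α β (F i) (hF i) (hF' i)]
  have main := sourceKP_of_wronskian (dirDeriv (1, 0, 0)) (dirDeriv (0, 1, 0)) (dirDeriv (0, 0, 1))
    (dirDeriv_comm _ _) (dirDeriv_comm _ _)
    (algebraMap ℝ smoothFunctions α) (algebraMap ℝ smoothFunctions β)
    (Derivation.map_algebraMap _ _) (Derivation.map_algebraMap _ _) (Derivation.map_algebraMap _ _)
    hS gS φS
    (fun i => by
      simp [φS, dirDeriv_travelling α β _ (hF' i) ((contDiff_infty_iff_deriv (𝕜 := ℝ)).1 (hF' i)).2])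
    (fun i => by
      have := hflow (0, 1, 0) i (fun w => dirDeriv (1, 0, 0) (dirDeriv (1, 0, 0) w))
        (fun w₁ w₂ => by simp [hFx])
        (toF3_injective (by
          rw [← py_toF3, ← px_toF3, ← px_toF3]
          exact funext fun x => funext fun y => funext fun t => (hfl i).1 x y t))
        (toF3_injective (by
          rw [← py_toF3, ← px_toF3, ← px_toF3]
          exact funext fun x => funext fun y => funext fun t => (hgl i).1 x y t))
      simpa using this)
    (fun i => by
      have := hflow (0, 0, 1) i
        (fun w => dirDeriv (1, 0, 0) (dirDeriv (1, 0, 0) (dirDeriv (1, 0, 0) w)))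
        (fun w₁ w₂ => by simp [hFx])
        (toF3_injective (by
          rw [← pt_toF3, ← px_toF3, ← px_toF3, ← px_toF3]
          exact funext fun x => funext fun y => funext fun t => (hfl i).2 x y t))
        (toF3_injective (by
          rw [← pt_toF3, ← px_toF3, ← px_toF3, ← px_toF3]
          exact funext fun x => funext fun y => funext fun t => (hgl i).2 x y t))
      simpa using this)
    τi (mul_recip _ hne) _ rfl _ _ (fun _ => rfl) (fun _ => rfl)
  rw [hu, hvS, funext hqS, funext hrS]
  exact E0N_toF3 α β _ _ _ main
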